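/- Let N ∈ ℕ, 1 ≤ n ≤ N, α, β ∈ (−1, +∞) and p ∈ (0,1). Let x_{1,n}^Q < ... < x_{n,n}^Q denote the roots of the Hahn polynomial Q_n(x;α,β,N) and x_{1,n}^K < ... < x_{n,n}^K denote the roots of the Krawtchouk polynomial K_n(x;p,N). If p/(1−p) > (α+N+1)/(β+1) then x_{j,n}^Q < x_{j,n}^K for every j = 1,...,n, and if p/(1−p) < (α+1)/(N+β+1) then x_{j,n}^Q > x_{j,n}^K for every j = 1,...,n. -/

import Mathlib

open Polynomial Filter

noncomputable def deltaOp (h : ℝ) (f : ℝ → ℝ) (x : ℝ) : ℝ := f (x + h) - f x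

noncomputable def nablaOp (h : ℝ) (f : ℝ → ℝ) (x : ℝ) : ℝ := f x - f (x - h)

noncomputable def forceF (h x y : ℝ) : ℝ := 1 / (2 * h) * Real.log ((y - x + h) / (y - x - h))

noncomputable def potV (h x y : ℝ) : ℝ :=
  (x - y) / (2 * h) * Real.log ((y - x + h) / (y - x - h))
    - 1 / 2 * Real.log ((y - x + h) * (y - x - h))

noncomputable def extForce (h : ℝ) (A B : Polynomial ℝ) (x : ℝ) : ℝ :=
  1 / (2 * h) * Real.log (1 + B.eval x / A.eval x)

noncomputable def energy (h : ℝ) (φ : ℝ → ℝ) {n : ℕ} (x : Fin n → ℝ) : ℝ :=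
  (∑ j, ∑ k ∈ Finset.univ.erase j, potV h (x k) (x j)) + 2 * ∑ j, φ (x j)

def GapGt (h : ℝ) {n : ℕ} (x : Fin n → ℝ) : Prop :=
  ∀ i : ℕ, ∀ hi : i + 1 < n, x ⟨i + 1, hi⟩ - x ⟨i, Nat.lt_of_succ_lt hi⟩ > h

def SatisfiesDiffEq (h : ℝ) (A B C p : Polynomial ℝ) : Prop :=
  ∀ x : ℝ,
    A.eval x * deltaOp h (nablaOp h fun t => p.eval t) x
      + B.eval x * deltaOp h (fun t => p.eval t) x + C.eval x * p.eval x = 0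

def InIoo (a b : EReal) (y : ℝ) : Prop := a < (y : EReal) ∧ (y : EReal) < b

def IsCriticalDist (h : ℝ) (A B : Polynomial ℝ) (a b : EReal) {n : ℕ}
    (x : Fin n → ℝ) : Prop :=
  StrictMono x ∧ (∀ j, InIoo a b (x j)) ∧ GapGt h x ∧
    ∀ j, (∑ k ∈ Finset.univ.erase j, forceF h (x k) (x j)) + extForce h A B (x j) = 0

def Admissible (h : ℝ) (a b : EReal) {n : ℕ} (x : Fin n → ℝ) : Prop :=
  StrictMono x ∧ (∀ j, a ≤ (x j : EReal) ∧ (x j : EReal) ≤ b) ∧ GapGt h x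

def IsEquilibrium (h : ℝ) (φ : ℝ → ℝ) (a b : EReal) {n : ℕ} (x : Fin n → ℝ) : Prop :=
  Admissible h a b x ∧ ∀ y : Fin n → ℝ, Admissible h a b y → energy h φ x ≤ energy h φ y

noncomputable def ratFn (A B : Polynomial ℝ) (x : ℝ) : ℝ := 1 + B.eval x / A.eval x

def GConvexOn (A B : Polynomial ℝ) (a b : EReal) : Prop :=
  a < b ∧
  (∀ x : ℝ, InIoo a b x → 0 < ratFn A B x) ∧
  (∀ x y : ℝ, InIoo a b x → InIoo a b y → x < y → ratFn A B y < ratFn A B x) ∧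
  (∀ a' : ℝ, a = (a' : EReal) → A.eval a' = 0) ∧
  (a = ⊥ → (Tendsto (ratFn A B) atBot atTop ∨
      ∃ L : ℝ, 1 < L ∧ Tendsto (ratFn A B) atBot (nhds L))) ∧
  (∀ b' : ℝ, b = (b' : EReal) → (A + B).eval b' = 0) ∧
  (b = ⊤ → ∃ L : ℝ, 0 ≤ L ∧ L < 1 ∧ Tendsto (ratFn A B) atTop (nhds L))

def IsPotential (h : ℝ) (A B : Polynomial ℝ) (a b : EReal) (φ : ℝ → ℝ) : Prop :=
  ∀ x : ℝ, InIoo a b x → HasDerivAt φ (-(extForce h A B x)) x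

noncomputable def partialD {n : ℕ} (f : (Fin n → ℝ) → ℝ) (j : Fin n) (z : Fin n → ℝ) : ℝ :=
  deriv (fun t => f (Function.update z j t)) (z j)

noncomputable def poch (t : ℝ) (k : ℕ) : ℝ := (ascPochhammer ℝ k).eval t

noncomputable def negXPoch (k : ℕ) : Polynomial ℝ := (ascPochhammer ℝ k).comp (-Polynomial.X)

noncomputable def charlier (n : ℕ) (a : ℝ) : Polynomial ℝ :=
  ∑ k ∈ Finset.range (n + 1),
    Polynomial.C (poch (-(n : ℝ)) k / (k.factorial : ℝ) * (-1 / a) ^ k) * negXPoch k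

noncomputable def krawtchouk (n : ℕ) (p : ℝ) (N : ℕ) : Polynomial ℝ :=
  ∑ k ∈ Finset.range (n + 1),
    Polynomial.C (poch (-(n : ℝ)) k / ((k.factorial : ℝ) * poch (-(N : ℝ)) k) * (1 / p) ^ k) *
      negXPoch k

noncomputable def meixner (n : ℕ) (β c : ℝ) : Polynomial ℝ :=
  ∑ k ∈ Finset.range (n + 1),
    Polynomial.C (poch (-(n : ℝ)) k / ((k.factorial : ℝ) * poch β k) * (1 - 1 / c) ^ k) *
      negXPoch k

noncomputable def hahn (n : ℕ) (α β : ℝ) (N : ℕ) : Polynomial ℝ :=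
  ∑ k ∈ Finset.range (n + 1),
    Polynomial.C (poch (-(n : ℝ)) k * poch ((n : ℝ) + α + β + 1) k /
        ((k.factorial : ℝ) * poch (α + 1) k * poch (-(N : ℝ)) k)) * negXPoch k

def IsRootTuple {n : ℕ} (p : Polynomial ℝ) (x : Fin n → ℝ) : Prop :=
  StrictMono x ∧ ∀ y : ℝ, p.IsRoot y ↔ ∃ j, y = x j

/-- The functional `f ↦ ∑_{i ≤ N} w i * f i` of a weight on the lattice `{0, …, N}`. -/
noncomputable def latticeFunctional (w : ℕ → ℝ) (N : ℕ) : ℝ[X] →ₗ[ℝ] ℝ :=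
  ∑ i ∈ Finset.range (N + 1), w i • Polynomial.leval (i : ℝ)

theorem latticeFunctional_apply (w : ℕ → ℝ) (N : ℕ) (f : ℝ[X]) :
    latticeFunctional w N f = ∑ i ∈ Finset.range (N + 1), w i * f.eval (i : ℝ) := by
  simp [latticeFunctional, LinearMap.sum_apply]

/-- Gauss quadrature for a functional annihilating all multiples of the nodal polynomial by
polynomials of degree `< n`, with nonnegative quadrature weights. -/
theorem exists_gauss_quadrature {n : ℕ} (L : ℝ[X] →ₗ[ℝ] ℝ) (hL : ∀ f, 0 ≤ L (f ^ 2))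
    {x : Fin n → ℝ} (hx : Function.Injective x)
    (horth : ∀ a : ℝ[X], a.degree < n → L (Lagrange.nodal Finset.univ x * a) = 0) :
    ∃ c : Fin n → ℝ, (∀ k, 0 ≤ c k) ∧
      ∀ f : ℝ[X], f.degree < (2 * n : ℕ) → L f = ∑ k, c k * f.eval (x k) := by
  have hinj : Set.InjOn x (Finset.univ : Finset (Fin n)) := hx.injOn
  have key : ∀ f : ℝ[X], f.degree < (2 * n : ℕ) →
      L f = ∑ k, L (Lagrange.basis Finset.univ x k) * f.eval (x k) := by
    intro f hf
    have hmod := EuclideanDomain.div_add_mod f (Lagrange.nodal Finset.univ x)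
    have hmonic : (Lagrange.nodal Finset.univ x).Monic := Lagrange.nodal_monic
    have hdegmod : (f % Lagrange.nodal Finset.univ x).degree < (Finset.univ : Finset (Fin n)).card := by
      simpa [Lagrange.degree_nodal] using Polynomial.degree_mod_lt f hmonic.ne_zero
    have hdiv : (f / Lagrange.nodal Finset.univ x).degree < n := by
      by_cases h0 : f / Lagrange.nodal Finset.univ x = 0
      · rw [h0, degree_zero]; exact WithBot.bot_lt_coe n
      have hle : (Lagrange.nodal Finset.univ x).degree ≤ f.degree := by
        by_contra hlt
        exact h0 ((Polynomial.div_eq_zero_iff hmonic.ne_zero).2 (not_le.1 hlt))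
      have hadd := Polynomial.degree_add_div hmonic.ne_zero hle
      rw [Lagrange.degree_nodal, Finset.card_univ, Fintype.card_fin,
        degree_eq_natDegree h0] at hadd
      rw [← hadd] at hf
      rw [degree_eq_natDegree h0]
      norm_cast at hf ⊢
      omega
    have hev : ∀ k, (f % Lagrange.nodal Finset.univ x).eval (x k) = f.eval (x k) := by
      intro k
      conv_rhs => rw [← hmod]
      simp [Lagrange.eval_nodal_at_node]
    have hint := Lagrange.eq_interpolate hinj hdegmod
    conv_lhs => rw [← hmod, map_add, horth _ hdiv, hint, zero_add, Lagrange.interpolate_apply]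
    rw [map_sum]
    refine Finset.sum_congr rfl fun k _ => ?_
    rw [hev, ← smul_eq_C_mul, map_smul, smul_eq_mul, mul_comm]
  refine ⟨fun k => L (Lagrange.basis Finset.univ x k), fun k => ?_, key⟩
  have hdeg : (Lagrange.basis Finset.univ x k ^ 2).degree < (2 * n : ℕ) := by
    rw [degree_pow, Lagrange.degree_basis hinj (Finset.mem_univ k)]
    have := k.pos
    simp only [Finset.card_univ, Fintype.card_fin]
    rw [nsmul_eq_mul]
    norm_cast
    omega
  have h := key _ hdeg
  rw [Finset.sum_eq_single k] at h
  · have h1 := Lagrange.eval_basis_self hinj (Finset.mem_univ k)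
    simp only [eval_pow, h1, one_pow, mul_one] at h
    exact (hL _).trans_eq h
  · intro b _ hb
    simp [Lagrange.eval_basis_of_ne hb.symm (Finset.mem_univ b)]
  · simp

/-- A discrete form of Markov's theorem: increasing the ratio of the weights moves the zeros of
the orthogonal polynomials to the right. -/
theorem lattice_markov {N n : ℕ} (hnN : n ≤ N) {w W : ℕ → ℝ}
    (hw : ∀ i ≤ N, 0 < w i) (hW : ∀ i ≤ N, 0 < W i)
    (hmono : ∀ i < N, W i * w (i + 1) < W (i + 1) * w i)
    {x X' : Fin n → ℝ} (hx : StrictMono x) (hX : StrictMono X')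
    (hxo : ∀ a : ℝ[X], a.degree < n →
      latticeFunctional w N (Lagrange.nodal Finset.univ x * a) = 0)
    (hXo : ∀ a : ℝ[X], a.degree < n →
      latticeFunctional W N (Lagrange.nodal Finset.univ X' * a) = 0) (j : Fin n) :
    x j < X' j := by
  by_contra! hle
  have hratio : ∀ i k, i < k → k ≤ N → W i / w i < W k / w k := by
    intro i k hik hk
    induction k, hik using Nat.le_induction with
    | base =>
      rw [div_lt_div_iff₀ (hw _ (by omega)) (hw _ hk)]
      exact hmono i (by omega)
    | succ k hik ih =>
      refine (ih (by omega)).trans ?_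
      rw [div_lt_div_iff₀ (hw _ (by omega)) (hw _ hk)]
      exact hmono k (by omega)
  obtain ⟨r, hrlo, hrhi⟩ := Order.exists_between_finsets
    (lo := insert 0 (((Finset.range (N + 1)).filter fun i : ℕ => (i : ℝ) < x j).image
      fun i => W i / w i))
    (hi := ((Finset.range (N + 1)).filter fun i : ℕ => x j < (i : ℝ)).image fun i => W i / w i)
    (by
      simp only [Finset.mem_insert, Finset.mem_image, Finset.mem_filter, Finset.mem_range]
      rintro _ (rfl | ⟨i, ⟨hi, hi'⟩, rfl⟩) _ ⟨k, ⟨hk, hk'⟩, rfl⟩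
      · exact div_pos (hW _ (by omega)) (hw _ (by omega))
      · exact hratio i k (by exact_mod_cast hi'.trans hk') (by omega))
  have hr0 : 0 < r := hrlo 0 (by simp)
  have hr1 : ∀ i ≤ N, (i : ℝ) < x j → W i < r * w i := by
    intro i hi hij
    rw [← div_lt_iff₀ (hw i hi)]
    refine hrlo _ (Finset.mem_insert_of_mem (Finset.mem_image_of_mem _ ?_))
    simp only [Finset.mem_filter, Finset.mem_range]
    exact ⟨by omega, hij⟩
  have hr2 : ∀ i ≤ N, x j < (i : ℝ) → r * w i < W i := by
    intro i hi hij
    rw [← lt_div_iff₀ (hw i hi)]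
    refine hrhi _ (Finset.mem_image_of_mem _ ?_)
    simp only [Finset.mem_filter, Finset.mem_range]
    exact ⟨by omega, hij⟩
  set q : ℝ[X] := ∏ k ∈ Finset.univ.erase j, (X - C (if k < j then x k else X' k)) with hq
  have hqmonic : q.Monic := monic_prod_of_monic _ _ fun k _ => monic_X_sub_C _
  have hqdeg : q.natDegree = n - 1 := by
    rw [hq, natDegree_prod_of_monic _ _ fun k _ => monic_X_sub_C _]
    simp
  have hjpos := j.pos
  have hqx : ∀ k < j, q.eval (x k) = 0 := by
    intro k hk
    rw [hq, eval_prod]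
    exact Finset.prod_eq_zero (Finset.mem_erase.2 ⟨hk.ne, Finset.mem_univ k⟩) (by simp [hk])
  have hqX : ∀ k > j, q.eval (X' k) = 0 := by
    intro k hk
    rw [hq, eval_prod]
    exact Finset.prod_eq_zero (Finset.mem_erase.2 ⟨hk.ne', Finset.mem_univ k⟩)
      (by simp [not_lt.2 hk.le])
  have hg : ((X - C (x j)) * q).natDegree = n := by
    rw [(monic_X_sub_C _).natDegree_mul hqmonic, natDegree_X_sub_C, hqdeg]
    omega
  have hf : ((X - C (x j)) * q ^ 2).degree < ((2 * n : ℕ) : WithBot ℕ) := by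
    refine degree_le_natDegree.trans_lt ?_
    rw [(monic_X_sub_C _).natDegree_mul (hqmonic.pow 2), natDegree_X_sub_C, natDegree_pow, hqdeg]
    norm_cast
    omega
  have hpos : ∀ v : ℕ → ℝ, (∀ i ≤ N, 0 < v i) → ∀ f, 0 ≤ latticeFunctional v N (f ^ 2) := by
    intro v hv f
    rw [latticeFunctional_apply]
    refine Finset.sum_nonneg fun i hi => mul_nonneg (hv i ?_).le ?_
    · exact Nat.lt_succ_iff.1 (Finset.mem_range.1 hi)
    · rw [eval_pow]; positivity
  obtain ⟨c, hc, hcq⟩ := exists_gauss_quadrature _ (hpos w hw) hx.injective hxo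
  obtain ⟨d, hd, hdq⟩ := exists_gauss_quadrature _ (hpos W hW) hX.injective hXo
  have hLw : 0 ≤ latticeFunctional w N ((X - C (x j)) * q ^ 2) := by
    rw [hcq _ hf]
    refine Finset.sum_nonneg fun k _ => mul_nonneg (hc k) ?_
    rcases lt_or_ge k j with hk | hk
    · simp [hqx k hk]
    · simp only [eval_mul, eval_sub, eval_X, eval_C, eval_pow]
      exact mul_nonneg (sub_nonneg.2 (hx.monotone hk)) (sq_nonneg _)
  have hLW : latticeFunctional W N ((X - C (x j)) * q ^ 2) ≤ 0 := by
    rw [hdq _ hf]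
    refine Finset.sum_nonpos fun k _ => mul_nonpos_of_nonneg_of_nonpos (hd k) ?_
    rcases lt_or_ge j k with hk | hk
    · simp [hqX k hk]
    · simp only [eval_mul, eval_sub, eval_X, eval_C, eval_pow]
      exact mul_nonpos_of_nonpos_of_nonneg
        (sub_nonpos.2 ((hX.monotone hk).trans hle)) (sq_nonneg _)
  have hterm : ∀ i ≤ N, ((i : ℝ) - x j) * q.eval (i : ℝ) ≠ 0 →
      0 < (W i - r * w i) * (((i : ℝ) - x j) * q.eval (i : ℝ) ^ 2) := by
    intro i hi hne
    have hq2 : 0 < q.eval (i : ℝ) ^ 2 := by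
      have := right_ne_zero_of_mul hne
      positivity
    rcases lt_trichotomy (i : ℝ) (x j) with h | h | h
    · exact mul_pos_of_neg_of_neg (sub_neg.2 (hr1 i hi h))
        (mul_neg_of_neg_of_pos (sub_neg.2 h) hq2)
    · exact absurd (by simp [h]) hne
    · exact mul_pos (sub_pos.2 (hr2 i hi h)) (mul_pos (sub_pos.2 h) hq2)
  have hsum : 0 < ∑ i ∈ Finset.range (N + 1),
      (W i - r * w i) * (((i : ℝ) - x j) * q.eval (i : ℝ) ^ 2) := by
    refine Finset.sum_pos' (fun i hi => ?_) ?_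
    · by_cases h : ((i : ℝ) - x j) * q.eval (i : ℝ) = 0
      · rw [pow_two, ← mul_assoc ((i : ℝ) - x j), h]; simp
      · exact (hterm i (Nat.lt_succ_iff.1 (Finset.mem_range.1 hi)) h).le
    · by_contra! hall
      refine ((monic_X_sub_C (x j)).mul hqmonic).ne_zero
        (eq_zero_of_natDegree_lt_card_of_eval_eq_zero (R := ℝ)
          (ι := Fin (N + 1)) _ (f := fun i : Fin (N + 1) => ((i : ℕ) : ℝ)) ?_ (fun i => ?_) ?_)
      · intro a b hab
        exact Fin.ext (Nat.cast_injective hab)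
      · by_contra hne
        rw [eval_mul, eval_sub, eval_X, eval_C] at hne
        exact absurd (hterm i (Nat.lt_succ_iff.1 i.2) hne)
          (not_lt.2 (hall i (Finset.mem_range.2 i.2)))
      · rw [hg, Fintype.card_fin]; omega
  have hexp : ∑ i ∈ Finset.range (N + 1),
      (W i - r * w i) * (((i : ℝ) - x j) * q.eval (i : ℝ) ^ 2) =
      latticeFunctional W N ((X - C (x j)) * q ^ 2) -
        r * latticeFunctional w N ((X - C (x j)) * q ^ 2) := by
    rw [latticeFunctional_apply, latticeFunctional_apply, Finset.mul_sum,
      ← Finset.sum_sub_distrib]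
    refine Finset.sum_congr rfl fun i _ => ?_
    simp only [eval_mul, eval_sub, eval_X, eval_C, eval_pow]
    ring
  have := mul_nonneg hr0.le hLw
  linarith

theorem sum_antidiagonal_shift (F : ℕ → ℕ → ℝ) (k M : ℕ) (hF : ∀ i < k, ∀ j, F i j = 0) :
    ∑ q ∈ Finset.HasAntidiagonal.antidiagonal (M + k), F q.1 q.2 =
      ∑ q ∈ Finset.HasAntidiagonal.antidiagonal M, F (q.1 + k) q.2 := by
  induction k generalizing F with
  | zero => simp
  | succ k ih =>
    rw [← add_assoc, Finset.Nat.sum_antidiagonal_succ, hF 0 (by omega), zero_add,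
      ih (fun i j => F (i + 1) j) fun i hi j => hF _ (by omega) j]
    simp only [add_assoc]

theorem sum_antidiagonal_swap (F : ℕ → ℕ → ℝ) (M : ℕ) :
    ∑ q ∈ Finset.HasAntidiagonal.antidiagonal M, F q.1 q.2 = ∑ q ∈ Finset.HasAntidiagonal.antidiagonal M, F q.2 q.1 :=
  (Finset.Nat.sum_antidiagonal_swap (f := fun q => F q.1 q.2)).symm

theorem sum_antidiagonal_descFactorial {u v u' v' : ℕ → ℝ} {c d : ℝ} {k m : ℕ} (M : ℕ)
    (hu : ∀ i, u (i + k) * (i + k).descFactorial k = c * u' i)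
    (hv : ∀ j, v (j + m) * (j + m).descFactorial m = d * v' j) :
    ∑ q ∈ Finset.HasAntidiagonal.antidiagonal (M + m + k),
      u q.1 * v q.2 * (q.1.descFactorial k * q.2.descFactorial m) =
      c * d * ∑ q ∈ Finset.HasAntidiagonal.antidiagonal M, u' q.1 * v' q.2 := by
  rw [sum_antidiagonal_shift
      (fun i j => u i * v j * (i.descFactorial k * j.descFactorial m)) k (M + m)
      (fun i hi j => by simp [Nat.descFactorial_of_lt hi]),
    sum_antidiagonal_swap
      (fun i j => u (i + k) * v j * ((i + k).descFactorial k * j.descFactorial m)),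
    sum_antidiagonal_shift
      (fun i j => u (j + k) * v i * ((j + k).descFactorial k * i.descFactorial m)) m M
      (fun i hi j => by simp [Nat.descFactorial_of_lt hi]),
    sum_antidiagonal_swap (fun i j => u (j + k) * v (i + m) *
      ((j + k).descFactorial k * (i + m).descFactorial m)), Finset.mul_sum]
  refine Finset.sum_congr rfl fun q _ => ?_
  linear_combination u (q.1 + k) * (q.1 + k).descFactorial k * hv q.2 + d * v' q.2 * hu q.1

theorem poch_add (a : ℝ) (k i : ℕ) : poch a (k + i) = poch a k * poch (a + k) i := by
  have := congrArg (eval a) (ascPochhammer_mul ℝ k i)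
  simpa [poch] using this.symm

theorem poch_div_factorial_mul_descFactorial (a : ℝ) (k i : ℕ) :
    poch a (i + k) / (i + k).factorial * (i + k).descFactorial k =
      poch a k * (poch (a + k) i / i.factorial) := by
  have h := Nat.factorial_mul_descFactorial (Nat.le_add_left k i)
  rw [Nat.add_sub_cancel] at h
  rw [add_comm i k, poch_add, add_comm k i, ← h]
  have h1 : (i.factorial : ℝ) ≠ 0 := by positivity
  have h2 : ((i + k).descFactorial k : ℝ) ≠ 0 := by
    exact_mod_cast (Nat.descFactorial_pos.2 (Nat.le_add_left k i)).ne'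
  push_cast
  field_simp

theorem pow_div_factorial_mul_descFactorial (p : ℝ) (k i : ℕ) :
    p ^ (i + k) / (i + k).factorial * (i + k).descFactorial k = p ^ k * (p ^ i / i.factorial) := by
  have h := Nat.factorial_mul_descFactorial (Nat.le_add_left k i)
  rw [Nat.add_sub_cancel] at h
  rw [← h]
  have h1 : (i.factorial : ℝ) ≠ 0 := by positivity
  have h2 : ((i + k).descFactorial k : ℝ) ≠ 0 := by
    exact_mod_cast (Nat.descFactorial_pos.2 (Nat.le_add_left k i)).ne'
  push_cast
  field_simp
  ring

theorem poch_succ_left (a : ℝ) (M : ℕ) : poch a (M + 1) = a * poch (a + 1) M := by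
  rw [add_comm, poch_add]
  simp [poch]

/-- The Chu–Vandermonde identity. -/
theorem sum_antidiagonal_poch (a b : ℝ) (M : ℕ) :
    ∑ q ∈ Finset.HasAntidiagonal.antidiagonal M, poch a q.1 / q.1.factorial * (poch b q.2 / q.2.factorial) =
      poch (a + b) M / M.factorial := by
  induction M generalizing a b with
  | zero => simp [poch]
  | succ M ih =>
    have h1 := sum_antidiagonal_descFactorial (k := 1) (m := 0)
      (u := fun i => poch a i / i.factorial)
      (u' := fun i => poch (a + (1 : ℕ)) i / i.factorial)
      (v := fun j => poch b j / j.factorial)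
      (v' := fun j => poch (b + (0 : ℕ)) j / j.factorial) M
      (poch_div_factorial_mul_descFactorial a 1) (poch_div_factorial_mul_descFactorial b 0)
    have h2 := sum_antidiagonal_descFactorial (k := 0) (m := 1)
      (v := fun j => poch b j / j.factorial)
      (v' := fun j => poch (b + (1 : ℕ)) j / j.factorial)
      (u := fun i => poch a i / i.factorial)
      (u' := fun i => poch (a + (0 : ℕ)) i / i.factorial) M
      (poch_div_factorial_mul_descFactorial a 0) (poch_div_factorial_mul_descFactorial b 1)
    simp only [Nat.cast_one, Nat.cast_zero, add_zero, ih] at h1 h2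
    have h3 : ((M : ℝ) + 1) * ∑ q ∈ Finset.HasAntidiagonal.antidiagonal (M + 1),
        poch a q.1 / q.1.factorial * (poch b q.2 / q.2.factorial) =
        (a + b) * (poch (a + b + 1) M / M.factorial) := by
      calc _ = ∑ q ∈ Finset.HasAntidiagonal.antidiagonal (M + 1),
            (poch a q.1 / q.1.factorial * (poch b q.2 / q.2.factorial) *
              (q.1.descFactorial 1 * q.2.descFactorial 0) +
            poch a q.1 / q.1.factorial * (poch b q.2 / q.2.factorial) *
              (q.1.descFactorial 0 * q.2.descFactorial 1)) := by
            rw [Finset.mul_sum]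
            refine Finset.sum_congr rfl fun q hq => ?_
            have hq' : ((q.1 : ℝ) + q.2) = M + 1 := by
              exact_mod_cast Finset.HasAntidiagonal.mem_antidiagonal.1 hq
            rw [← hq']
            simp
            ring
        _ = _ := by
            rw [Finset.sum_add_distrib, h1, h2]
            simp only [poch, ascPochhammer_zero, ascPochhammer_one, eval_one, eval_X]
            rw [show a + 1 + b = a + b + 1 by ring, ← add_assoc a b 1]
            ring
    rw [poch_succ_left, Nat.factorial_succ]
    have h4 : (M.factorial : ℝ) ≠ 0 := by positivity
    have h5 : ((M : ℝ) + 1) ≠ 0 := by positivity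
    push_cast
    rw [← mul_right_inj' h5, h3]
    field_simp

theorem sum_antidiagonal_pow (p q : ℝ) (M : ℕ) :
    ∑ z ∈ Finset.HasAntidiagonal.antidiagonal M, p ^ z.1 / z.1.factorial * (q ^ z.2 / z.2.factorial) =
      (p + q) ^ M / M.factorial := by
  rw [(Commute.all p q).add_pow', Finset.sum_div]
  refine Finset.sum_congr rfl fun z hz => ?_
  obtain rfl := Finset.HasAntidiagonal.mem_antidiagonal.1 hz
  have h := Nat.add_choose_mul_factorial_mul_factorial z.1 z.2
  rw [nsmul_eq_mul, Nat.choose_symm_add, ← h]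
  have h1 : (z.1.factorial : ℝ) ≠ 0 := by positivity
  have h2 : (z.2.factorial : ℝ) ≠ 0 := by positivity
  have h3 : ((z.1 + z.2).choose z.2 : ℝ) ≠ 0 := by
    exact_mod_cast (Nat.choose_pos (Nat.le_add_left _ _)).ne'
  push_cast
  field_simp

theorem poch_neg_natCast (n k : ℕ) : poch (-(n : ℝ)) k = (-1) ^ k * n.descFactorial k := by
  rw [poch, ascPochhammer_eval_neg_eq_descPochhammer, descPochhammer_eval_eq_descFactorial]

theorem eval_negXPoch_natCast (k i : ℕ) :
    (negXPoch k).eval (i : ℝ) = (-1) ^ k * i.descFactorial k := by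
  rw [negXPoch, eval_comp, eval_neg, eval_X, ← poch_neg_natCast, poch]

theorem natDegree_negXPoch (k : ℕ) : (negXPoch k).natDegree = k := by
  rw [negXPoch, natDegree_comp, ascPochhammer_natDegree, natDegree_neg, natDegree_X, mul_one]

theorem sum_neg_one_pow_choose_mul_eval_eq_zero {n : ℕ} {R : ℝ[X]} (hR : R.natDegree < n) :
    ∑ k ∈ Finset.range (n + 1), (-1 : ℝ) ^ k * n.choose k * R.eval (k : ℝ) = 0 := by
  have h := congrFun (Polynomial.fwdDiff_iter_eq_zero_of_degree_lt hR) 0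
  rw [fwdDiff_iter_eq_sum_shift] at h
  have h2 : ∑ k ∈ Finset.range (n + 1), (-1 : ℝ) ^ k * n.choose k * R.eval (k : ℝ) =
      (-1) ^ n * ∑ k ∈ Finset.range (n + 1),
        ((-1 : ℤ) ^ (n - k) * n.choose k) • R.eval (0 + k • (1 : ℝ)) := by
    rw [Finset.mul_sum]
    refine Finset.sum_congr rfl fun k hk => ?_
    have hk : k ≤ n := Nat.lt_succ_iff.1 (Finset.mem_range.1 hk)
    obtain ⟨l, rfl⟩ := Nat.exists_eq_add_of_le hk
    rw [Nat.add_sub_cancel_left, zsmul_eq_mul, pow_add]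
    have hs : (-1 : ℝ) ^ l * (-1) ^ l = 1 := by rw [← mul_pow]; simp
    push_cast
    simp only [nsmul_eq_mul, mul_one, zero_add]
    linear_combination (-(-1 : ℝ) ^ k * (k + l).choose k * R.eval (k : ℝ)) * hs
  rw [h2, h]
  simp

/-- The polynomial `∑_k (-n)_k / (k! (-N)_k) h_k (-x)_k`, common form of the Hahn and Krawtchouk
polynomials. -/
noncomputable def latticeSeries (n N : ℕ) (h : ℕ → ℝ) : ℝ[X] :=
  ∑ k ∈ Finset.range (n + 1),
    C (poch (-(n : ℝ)) k / ((k.factorial : ℝ) * poch (-(N : ℝ)) k) * h k) * negXPoch k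

theorem natDegree_latticeSeries_le (n N : ℕ) (h : ℕ → ℝ) :
    (latticeSeries n N h).natDegree ≤ n := by
  refine natDegree_sum_le_of_forall_le _ _ fun k hk => (natDegree_C_mul_le _ _).trans ?_
  rw [natDegree_negXPoch]
  exact Nat.lt_succ_iff.1 (Finset.mem_range.1 hk)

theorem latticeFunctional_latticeSeries_mul_descPochhammer {n N m : ℕ} (hnN : n ≤ N)
    {u v v' h c : ℕ → ℝ} {u' : ℕ → ℕ → ℝ} {d : ℝ}
    (hu : ∀ k i, u (i + k) * (i + k).descFactorial k = c k * u' k i)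
    (hv : ∀ j, v (j + m) * (j + m).descFactorial m = d * v' j)
    {R : ℝ[X]} (hR : m + R.natDegree < n)
    (hS : ∀ k ≤ n, ∀ M, M + m + k = N →
      h k * c k * ∑ q ∈ Finset.HasAntidiagonal.antidiagonal M, u' k q.1 * v' q.2 =
        R.eval (k : ℝ) / M.factorial) :
    latticeFunctional (fun i => u i * v (N - i)) N
      (latticeSeries n N h * (descPochhammer ℝ m).comp (C (N : ℝ) - X)) = 0 := by
  have hfac : (N.factorial : ℝ) ≠ 0 := by positivity
  have hmoment : ∀ k ≤ n, h k * (∑ q ∈ Finset.HasAntidiagonal.antidiagonal N,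
      u q.1 * v q.2 * (q.1.descFactorial k * q.2.descFactorial m)) * (N - k).factorial =
      d * (((descPochhammer ℝ m).comp (C (N : ℝ) - X)) * R).eval (k : ℝ) := by
    intro k hk
    rw [eval_mul, eval_comp, eval_sub, eval_C, eval_X, ← Nat.cast_sub (hk.trans hnN),
      descPochhammer_eval_eq_descFactorial]
    by_cases hkm : m + k ≤ N
    · obtain ⟨M, hM⟩ := Nat.exists_eq_add_of_le hkm
      have hM' : M + m + k = N := by omega
      have hsum := sum_antidiagonal_descFactorial M (hu k) hv
      have hMfac : (M.factorial : ℝ) ≠ 0 := by positivity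
      have hfd := Nat.factorial_mul_descFactorial (show m ≤ N - k by omega)
      rw [show N - k - m = M by omega] at hfd
      rw [hM'] at hsum
      rw [hsum, ← hfd]
      have hSk := hS k hk M hM'
      rw [eq_div_iff hMfac] at hSk
      push_cast
      linear_combination d * ((N - k).descFactorial m) * hSk
    · rw [Nat.descFactorial_of_lt (by omega), Finset.sum_eq_zero]
      · simp
      · intro q hq
        have := Finset.HasAntidiagonal.mem_antidiagonal.1 hq
        rcases lt_or_ge q.1 k with h1 | h1
        · simp [Nat.descFactorial_of_lt h1]
        · simp [Nat.descFactorial_of_lt (show q.2 < m by omega)]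
  have hdeg : ((descPochhammer ℝ m).comp (C (N : ℝ) - X) * R).natDegree < n := by
    refine natDegree_mul_le.trans_lt (lt_of_le_of_lt ?_ hR)
    gcongr
    refine natDegree_comp_le.trans ?_
    rw [descPochhammer_natDegree]
    have : (C (N : ℝ) - X).natDegree ≤ 1 :=
      (natDegree_sub_le _ _).trans (by simp)
    simpa using Nat.mul_le_mul_left m this
  have hzero := sum_neg_one_pow_choose_mul_eval_eq_zero hdeg
  have hexpand : latticeFunctional (fun i => u i * v (N - i)) N
      (latticeSeries n N h * (descPochhammer ℝ m).comp (C (N : ℝ) - X)) =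
      ∑ k ∈ Finset.range (n + 1), (poch (-(n : ℝ)) k / (k.factorial * poch (-(N : ℝ)) k) * h k) *
        ((-1) ^ k * ∑ q ∈ Finset.HasAntidiagonal.antidiagonal N,
          u q.1 * v q.2 * (q.1.descFactorial k * q.2.descFactorial m)) := by
    rw [latticeSeries, Finset.sum_mul, map_sum]
    refine Finset.sum_congr rfl fun k _ => ?_
    rw [mul_assoc, ← smul_eq_C_mul, map_smul, smul_eq_mul, latticeFunctional_apply,
      Finset.Nat.sum_antidiagonal_eq_sum_range_succ
        (fun i j => u i * v j * (i.descFactorial k * j.descFactorial m))]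
    congr 1
    rw [Finset.mul_sum]
    refine Finset.sum_congr rfl fun i hi => ?_
    have hi : i ≤ N := Nat.lt_succ_iff.1 (Finset.mem_range.1 hi)
    rw [eval_mul, eval_comp, eval_sub, eval_C, eval_X, ← Nat.cast_sub hi,
      descPochhammer_eval_eq_descFactorial, eval_negXPoch_natCast]
    ring
  rw [hexpand, ← mul_right_inj' hfac, mul_zero, Finset.mul_sum,
    ← mul_zero d, ← hzero, Finset.mul_sum]
  refine Finset.sum_congr rfl fun k hk => ?_
  have hk : k ≤ n := Nat.lt_succ_iff.1 (Finset.mem_range.1 hk)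
  have hNk : ((N - k).factorial : ℝ) * N.descFactorial k = N.factorial := by
    exact_mod_cast Nat.factorial_mul_descFactorial (hk.trans hnN)
  have hd0 : (N.descFactorial k : ℝ) ≠ 0 := by
    exact_mod_cast (Nat.descFactorial_pos.2 (hk.trans hnN)).ne'
  have hk0 : (k.factorial : ℝ) ≠ 0 := by positivity
  have hs : (-1 : ℝ) ^ k ≠ 0 := by simp
  have hm := hmoment k hk
  set T := ∑ q ∈ Finset.HasAntidiagonal.antidiagonal N,
    u q.1 * v q.2 * (q.1.descFactorial k * q.2.descFactorial m : ℝ)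
  rw [poch_neg_natCast, poch_neg_natCast, Nat.descFactorial_eq_factorial_mul_choose n k, ← hNk]
  push_cast
  field_simp
  linear_combination (n.choose k : ℝ) * hm

theorem map_mul_eq_zero_of_descPochhammer {L : ℝ[X] →ₗ[ℝ] ℝ} {P : ℝ[X]} {n : ℕ} (t : ℝ)
    (h : ∀ m < n, L (P * (descPochhammer ℝ m).comp (C t - X)) = 0)
    (a : ℝ[X]) (ha : a.degree < n) : L (P * a) = 0 := by
  induction n generalizing a with
  | zero =>
    have : a = 0 := by
      rw [← degree_eq_bot]
      exact Nat.WithBot.lt_zero_iff.1 (by simpa using ha)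
    simp [this]
  | succ n ih =>
    set b := (descPochhammer ℝ n).comp (C t - X) with hb
    have hbdeg : b.natDegree = n := by
      have : (C t - X : ℝ[X]).natDegree = 1 := by
        rw [natDegree_sub_eq_right_of_natDegree_lt] <;> simp
      rw [hb, natDegree_comp, descPochhammer_natDegree, this, mul_one]
    have hbn : b.coeff n ≠ 0 := by
      have hb0 : b ≠ 0 := by
        intro h0
        have h1 : (b.comp (C t - X)) = descPochhammer ℝ n := by
          rw [hb, comp_assoc]; simp
        rw [h0, zero_comp] at h1
        exact (monic_descPochhammer ℝ n).ne_zero h1.symm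
      rw [← hbdeg]
      exact leadingCoeff_ne_zero.2 hb0
    have hlow : (a - C (a.coeff n / b.coeff n) * b).degree < n := by
      rw [degree_lt_iff_coeff_zero]
      intro k hk
      rw [coeff_sub, coeff_C_mul]
      rcases hk.eq_or_lt with rfl | hk
      · field_simp; ring
      · rw [coeff_eq_zero_of_degree_lt (ha.trans_le (by exact_mod_cast hk)),
          coeff_eq_zero_of_natDegree_lt (hbdeg.trans_lt hk)]
        simp
    have hsplit : P * a = P * (a - C (a.coeff n / b.coeff n) * b) +
        (a.coeff n / b.coeff n) • (P * b) := by
      rw [smul_eq_C_mul]; ring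
    rw [hsplit, map_add, map_smul, h n (Nat.lt_succ_self n),
      ih (fun m hm => h m (hm.trans (Nat.lt_succ_self n))) _ hlow]
    simp

theorem nodal_orthogonal_of_isRootTuple {n : ℕ} {P : ℝ[X]} {x : Fin n → ℝ}
    (hP : IsRootTuple P x) (hdeg : P.natDegree ≤ n) {L : ℝ[X] →ₗ[ℝ] ℝ}
    (h : ∀ a : ℝ[X], a.degree < n → L (P * a) = 0) (a : ℝ[X]) (ha : a.degree < n) :
    L (Lagrange.nodal Finset.univ x * a) = 0 := by
  have hP0 : P ≠ 0 := by
    rintro rfl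
    refine Set.infinite_univ (α := ℝ) ((Set.finite_range x).subset fun y _ => ?_)
    obtain ⟨j, hj⟩ := (hP.2 y).1 (by simp [IsRoot])
    exact ⟨j, hj.symm⟩
  have hdvd : Lagrange.nodal Finset.univ x ∣ P := by
    rw [Lagrange.nodal_eq]
    refine Finset.prod_dvd_of_coprime
      (fun i _ j _ hij => pairwise_coprime_X_sub_C hP.1.injective hij) fun i _ => ?_
    exact dvd_iff_isRoot.2 ((hP.2 _).2 ⟨i, rfl⟩)
  obtain ⟨g, hg⟩ := hdvd
  have hg0 : g ≠ 0 := by rintro rfl; simp_all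
  have hgdeg : g.natDegree = 0 := by
    have := congrArg natDegree hg
    rw [natDegree_mul Lagrange.nodal_ne_zero hg0, Lagrange.natDegree_nodal] at this
    simp at this
    omega
  obtain ⟨c, rfl⟩ : ∃ c, g = C c := ⟨_, eq_C_of_natDegree_eq_zero hgdeg⟩
  have hc : c ≠ 0 := by rintro rfl; simp at hg0
  have := h a ha
  rw [hg, mul_right_comm, mul_comm, ← smul_eq_C_mul, map_smul, smul_eq_mul] at this
  exact (mul_eq_zero.1 this).resolve_left hc

theorem poch_pos {a : ℝ} (ha : 0 < a) (k : ℕ) : 0 < poch a k := ascPochhammer_pos k a ha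

theorem poch_succ_right (a : ℝ) (k : ℕ) : poch a (k + 1) = poch a k * (a + k) :=
  ascPochhammer_succ_eval k a

noncomputable def krawtchoukWeight (p : ℝ) (N i : ℕ) : ℝ :=
  p ^ i / i.factorial * ((1 - p) ^ (N - i) / (N - i).factorial)

noncomputable def hahnWeight (α β : ℝ) (N i : ℕ) : ℝ :=
  poch (α + 1) i / i.factorial * (poch (β + 1) (N - i) / (N - i).factorial)

theorem krawtchouk_nodal_orthogonal {N n : ℕ} (hnN : n ≤ N) {p : ℝ} (hp : p ≠ 0)
    {x : Fin n → ℝ} (hx : IsRootTuple (krawtchouk n p N) x) (a : ℝ[X]) (ha : a.degree < n) :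
    latticeFunctional (krawtchoukWeight p N) N (Lagrange.nodal Finset.univ x * a) = 0 := by
  change IsRootTuple (latticeSeries n N fun k => (1 / p) ^ k) x at hx
  refine nodal_orthogonal_of_isRootTuple hx (natDegree_latticeSeries_le _ _ _)
    (map_mul_eq_zero_of_descPochhammer (N : ℝ) fun m hm => ?_) a ha
  refine latticeFunctional_latticeSeries_mul_descPochhammer (R := 1)
    (u := fun i => p ^ i / i.factorial) (v := fun j => (1 - p) ^ j / j.factorial) hnN
    (pow_div_factorial_mul_descFactorial p) (pow_div_factorial_mul_descFactorial (1 - p) m)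
    (by simpa using hm) fun k _ M _ => ?_
  rw [sum_antidiagonal_pow, ← mul_pow, one_div_mul_cancel hp]
  simp

theorem hahn_nodal_orthogonal {N n : ℕ} (hnN : n ≤ N) {α β : ℝ} (hα : -1 < α) (hβ : -1 < β)
    {x : Fin n → ℝ} (hx : IsRootTuple (hahn n α β N) x) (a : ℝ[X]) (ha : a.degree < n) :
    latticeFunctional (hahnWeight α β N) N (Lagrange.nodal Finset.univ x * a) = 0 := by
  have hser : hahn n α β N =
      latticeSeries n N fun k => poch ((n : ℝ) + α + β + 1) k / poch (α + 1) k := by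
    refine Finset.sum_congr rfl fun k _ => ?_
    rw [div_mul_div_comm]
    congr 3
    ring
  rw [hser] at hx
  refine nodal_orthogonal_of_isRootTuple hx (natDegree_latticeSeries_le _ _ _)
    (map_mul_eq_zero_of_descPochhammer (N : ℝ) fun m hm => ?_) a ha
  obtain ⟨l, rfl⟩ : ∃ l, n = m + l + 1 := ⟨n - m - 1, by omega⟩
  set s : ℝ := α + 1 + (β + 1) with hs
  have hs0 : 0 < s := by rw [hs]; linarith
  refine latticeFunctional_latticeSeries_mul_descPochhammer
    (R := C (poch s N / poch s (m + l)) * (ascPochhammer ℝ l).comp (X + C (s + m)))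
    (u := fun i => poch (α + 1) i / i.factorial) (v := fun j => poch (β + 1) j / j.factorial)
    hnN (poch_div_factorial_mul_descFactorial (α + 1))
    (poch_div_factorial_mul_descFactorial (β + 1) m) ?_ fun k _ M hM => ?_
  · have : (C (poch s N / poch s (m + l)) *
        (ascPochhammer ℝ l).comp (X + C (s + m))).natDegree ≤ l := by
      refine (natDegree_C_mul_le _ _).trans ?_
      rw [natDegree_comp, ascPochhammer_natDegree, natDegree_X_add_C, mul_one]
    omega
  · have hc := (poch_pos (show 0 < α + 1 by linarith) k).ne'
    have hsl := (poch_pos hs0 (m + l)).ne'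
    have hsk := (poch_pos hs0 (m + k)).ne'
    rw [sum_antidiagonal_poch, div_mul_cancel₀ _ hc, ← mul_div_assoc]
    congr 1
    rw [eval_C_mul, eval_comp, eval_add, eval_X, eval_C]
    change _ = _ * poch _ _
    have e1 : poch s (m + l) * poch (s + (m + l : ℕ)) k =
        poch s (m + k) * poch (s + (m + k : ℕ)) l := by
      rw [← poch_add, ← poch_add]
      congr 1
      omega
    have e2 : poch s N = poch s (m + k) * poch (s + (m + k : ℕ)) M := by
      rw [← poch_add]
      congr 1
      omega
    rw [e2, show ((m + l + 1 : ℕ) : ℝ) + α + β + 1 = s + (m + l : ℕ) by push_cast; rw [hs]; ring,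
      show α + 1 + (k : ℝ) + (β + 1 + m) = s + (m + k : ℕ) by push_cast; rw [hs]; ring,
      show (k : ℝ) + (s + m) = s + (m + k : ℕ) by push_cast; ring]
    field_simp
    linear_combination poch (s + (m + k : ℕ)) M * e1

theorem krawtchoukWeight_pos {p : ℝ} (hp : 0 < p) (hp1 : p < 1) (N i : ℕ) :
    0 < krawtchoukWeight p N i := by
  have := sub_pos.2 hp1
  unfold krawtchoukWeight
  positivity

theorem hahnWeight_pos {α β : ℝ} (hα : -1 < α) (hβ : -1 < β) (N i : ℕ) :
    0 < hahnWeight α β N i := by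
  have h1 := poch_pos (show 0 < α + 1 by linarith) i
  have h2 := poch_pos (show 0 < β + 1 by linarith) (N - i)
  unfold hahnWeight
  positivity

/-- The cross-difference of the two weights, up to a positive factor. -/
theorem exists_pos_mul_weight_cross {α β p : ℝ} (hα : -1 < α) (hβ : -1 < β)
    (hp : 0 < p) (hp1 : p < 1) {N i : ℕ} (hi : i < N) :
    ∃ t > 0, krawtchoukWeight p N (i + 1) * hahnWeight α β N i -
      krawtchoukWeight p N i * hahnWeight α β N (i + 1) =
        t * (p * (β + N - i) - (1 - p) * (α + 1 + i)) := by
  obtain ⟨l, rfl⟩ := Nat.exists_eq_add_of_le hi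
  have h1 := poch_pos (show 0 < α + 1 by linarith) i
  have h2 := poch_pos (show 0 < β + 1 by linarith) l
  have h3 := sub_pos.2 hp1
  refine ⟨p ^ i * (1 - p) ^ l * poch (α + 1) i * poch (β + 1) l /
    ((i + 1).factorial * (l + 1).factorial * i.factorial * l.factorial), by positivity, ?_⟩
  simp only [krawtchoukWeight, hahnWeight, show i + 1 + l - (i + 1) = l by omega,
    show i + 1 + l - i = l + 1 by omega, poch_succ_right]
  have h4 : (i.factorial : ℝ) ≠ 0 := by positivity
  have h5 : (l.factorial : ℝ) ≠ 0 := by positivity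
  have h6 : ((i + 1).factorial : ℝ) ≠ 0 := by positivity
  have h7 : ((l + 1).factorial : ℝ) ≠ 0 := by positivity
  push_cast
  field_simp
  ring

/-- comparison between the roots of the Hahn polynomial `Q_n(·;α,β,N)` and the
Krawtchouk polynomial `K_n(·;p,N)`: if `p/(1−p) > (α+N+1)/(β+1)` then the Hahn roots are
componentwise smaller, and if `p/(1−p) < (α+1)/(N+β+1)` then they are componentwise larger. -/
theorem hahn_krawtchouk_roots_comparison
    (N : ℕ) (n : ℕ) (hn : 1 ≤ n) (hnN : n ≤ N)
    (α β p : ℝ) (hα : -1 < α) (hβ : -1 < β) (hp : 0 < p) (hp1 : p < 1)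
    (xQ xK : Fin n → ℝ)
    (hQ : IsRootTuple (hahn n α β N) xQ) (hK : IsRootTuple (krawtchouk n p N) xK) :
    (p / (1 - p) > (α + (N : ℝ) + 1) / (β + 1) → ∀ j, xQ j < xK j) ∧
    (p / (1 - p) < (α + 1) / ((N : ℝ) + β + 1) → ∀ j, xK j < xQ j) := by
  have hp1' : 0 < 1 - p := sub_pos.2 hp1
  have hb : 0 < β + 1 := by linarith
  have hNb : 0 < (N : ℝ) + β + 1 := by have := Nat.cast_nonneg (α := ℝ) N; linarith
  constructor
  · intro h
    rw [gt_iff_lt, div_lt_div_iff₀ hb hp1'] at h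
    refine lattice_markov hnN (fun i _ => hahnWeight_pos hα hβ N i)
      (fun i _ => krawtchoukWeight_pos hp hp1 N i) (fun i hi => ?_) hQ.1 hK.1
      (hahn_nodal_orthogonal hnN hα hβ hQ) (krawtchouk_nodal_orthogonal hnN hp.ne' hK)
    obtain ⟨t, ht, heq⟩ := exists_pos_mul_weight_cross hα hβ hp hp1 hi
    have hiN : (i : ℝ) + 1 ≤ N := by exact_mod_cast hi
    rw [← sub_pos, heq]
    refine mul_pos ht ?_
    nlinarith
  · intro h
    rw [div_lt_div_iff₀ hp1' hNb] at h
    refine lattice_markov hnN (fun i _ => krawtchoukWeight_pos hp hp1 N i)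
      (fun i _ => hahnWeight_pos hα hβ N i) (fun i hi => ?_) hK.1 hQ.1
      (krawtchouk_nodal_orthogonal hnN hp.ne' hK) (hahn_nodal_orthogonal hnN hα hβ hQ)
    obtain ⟨t, ht, heq⟩ := exists_pos_mul_weight_cross hα hβ hp hp1 hi
    have hi0 : (0 : ℝ) ≤ i := Nat.cast_nonneg i
    rw [mul_comm (hahnWeight _ _ _ _), mul_comm (hahnWeight _ _ _ _), ← sub_neg, heq]
    refine mul_neg_of_pos_of_neg ht ?_
    nlinarith
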